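/- Let R be a commutative Noetherian ring, n ≥ 1 an integer, M a (2n+1)×(2n+1) alternating matrix over R, i₀ ∈ {1,…,2n+1} an index, and x : R³ → R an R-linear map. Assume: (a) the ideal im(x) has grade 3; (b) the ideal Pf(M) of submaximal Pfaffians of M is a grade 3 Gorenstein ideal; (c) every entry of the i₀-th row of M lies in im(x); (d) the Pfaffian Pf_{i₀}(M) is a non-zerodivisor on R. Set 𝓘 = (Pf_j(M) : j ≠ i₀) + im(x)·Pf_{i₀}(M). Then R/𝓘 admits a free resolution of the form 0 → R² → R^{2n+4} → R^{2n+3} → R → R/𝓘 → 0; in particular 𝓘 is a perfect ideal of grade 3 and R/𝓘 has projective dimension 3 over R. -/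

import Mathlib

open MvPolynomial Module

noncomputable section

/-- The standard graded polynomial ring `k[x_1, …, x_n]` (each variable of degree 1). -/
abbrev MvP (n : ℕ) (k : Type) [Field k] := MvPolynomial (Fin n) k

variable {n : ℕ} {k : Type} [Field k]

/-- The irrelevant ideal `R₊ = (x_1, …, x_n)`. -/
def irrIdeal (n : ℕ) (k : Type) [Field k] : Ideal (MvP n k) :=
  Ideal.span (Set.range X)

/-- A homogeneous ideal (w.r.t. the standard grading). -/
def IsHomogIdeal (I : Ideal (MvP n k)) : Prop :=
  ∀ f ∈ I, ∀ j : ℕ, homogeneousComponent j f ∈ I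

/-- `gradeGE I m` : the ideal `I` contains an `R`-regular sequence of length `m`. -/
def gradeGE {R : Type} [CommRing R] (I : Ideal R) (m : ℕ) : Prop :=
  ∃ rs : List R, rs.length = m ∧ (∀ r ∈ rs, r ∈ I) ∧ RingTheory.Sequence.IsRegular R rs

/-- `hasGrade I m` : the grade (length of a maximal `R`-regular sequence contained in `I`)
is exactly `m`. -/
def hasGrade {R : Type} [CommRing R] (I : Ideal R) (m : ℕ) : Prop :=
  gradeGE I m ∧ ¬ gradeGE I (m + 1)

/-- `mu I` : the minimal number of generators of `I`. -/
def mu {R : Type} [CommRing R] (I : Ideal R) : ℕ :=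
  sInf {m | ∃ f : Fin m → R, Ideal.span (Set.range f) = I}

/-- The degree-`j` graded piece of `R/I` (the image of the degree-`j` forms). -/
def aDeg (I : Ideal (MvP n k)) (j : ℕ) : Submodule k (MvP n k ⧸ I) :=
  Submodule.map (Ideal.Quotient.mkₐ k I).toLinearMap (homogeneousSubmodule (Fin n) k j)

/-- The socle `(0 :_{R/I} R₊)` of `R/I`, as a `k`-subspace of `R/I`. -/
def socle (I : Ideal (MvP n k)) : Submodule k (MvP n k ⧸ I) where
  carrier := {a | ∀ i : Fin n, Ideal.Quotient.mk I (X i) * a = 0}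
  add_mem' := by intro a b ha hb i; rw [mul_add, ha i, hb i, add_zero]
  zero_mem' := by intro i; rw [mul_zero]
  smul_mem' := by intro c a ha i; rw [mul_smul_comm, ha i, smul_zero]

/-- `Soc(R/I) = k(-c)` : the socle is one–dimensional, concentrated in degree `c`.
(For an Artinian quotient this says exactly that `R/I` is Gorenstein with socle degree `c`.) -/
def SocleOne (I : Ideal (MvP n k)) (c : ℕ) : Prop :=
  finrank k (socle I) = 1 ∧ finrank k ↥(socle I ⊓ aDeg I c) = 1

/-- `Soc(R/I) = k(-a) ⊕ k(-b)` : the socle is two–dimensional, with one basis vector in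
degree `a` and one in degree `b`. -/
def SocleTwo (I : Ideal (MvP n k)) (a b : ℕ) : Prop :=
  finrank k (socle I) = 2 ∧
    finrank k ↥(socle I ⊓ aDeg I a) = 1 ∧ finrank k ↥(socle I ⊓ aDeg I b) = 1

/-- A standard graded Artinian algebra `A = R/I` with embedding dimension
`e = dim_k A₁`, top socle degree `s` (the largest `s` with `A_s = 𝔪^s ≠ 0`), and socle
polynomial `∑ cᵢ zⁱ` (where `cᵢ = dim_k (Soc A)ᵢ`) is compressed if
`dim_k Aᵢ = min { C(e-1+i, i), ∑_ℓ c_ℓ · C(e-1+ℓ-i, ℓ-i) }` for all `0 ≤ i ≤ s`. -/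
def IsCompressed (I : Ideal (MvP n k)) : Prop :=
  ∃ s : ℕ, aDeg I s ≠ ⊥ ∧ (∀ j, s < j → aDeg I j = ⊥) ∧
    ∀ i ≤ s,
      finrank k ↥(aDeg I i) =
        min (Nat.choose (finrank k ↥(aDeg I 1) - 1 + i) i)
          (∑ l ∈ Finset.Icc i s,
            finrank k ↥(socle I ⊓ aDeg I l) *
              Nat.choose (finrank k ↥(aDeg I 1) - 1 + (l - i)) (l - i))

/-- The image of `X i` in `R/I`. -/
def xq (I : Ideal (MvP n k)) (i : Fin n) : MvP n k ⧸ I :=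
  Ideal.Quotient.mk I (X i)

/-- The Pfaffian of a `2m × 2m` matrix (intended for alternating matrices), defined by
recursive expansion along the first row:
`pf(A) = ∑_j (-1)^j ⬝ A 0 (j+1) ⬝ pf(A with rows/columns 0 and j+1 removed)`. -/
def pfAux {R : Type} [CommRing R] :
    (m : ℕ) → Matrix (Fin (2 * m)) (Fin (2 * m)) R → R
  | 0, _ => 1
  | (m + 1), A =>
      ∑ j : Fin (2 * m + 1),
        (-1 : R) ^ (j : ℕ) * A 0 j.succ *
          pfAux m (A.submatrix (fun i : Fin (2 * m) => Fin.succ (j.succAbove i))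
            (fun i : Fin (2 * m) => Fin.succ (j.succAbove i)))

/-- `subPf M i` : the submaximal Pfaffian `Pf_i(M)` of a `(2m+1) × (2m+1)` (alternating)
matrix `M`: the Pfaffian of the matrix obtained by deleting the `i`-th row and column. -/
def subPf {R : Type} [CommRing R] {m : ℕ}
    (M : Matrix (Fin (2 * m + 1)) (Fin (2 * m + 1)) R) (i : Fin (2 * m + 1)) : R :=
  pfAux m (M.submatrix i.succAbove i.succAbove)

/-- The ideal `Pf(M)` of submaximal Pfaffians of `M`. -/
def pfIdeal {R : Type} [CommRing R] {m : ℕ}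
    (M : Matrix (Fin (2 * m + 1)) (Fin (2 * m + 1)) R) : Ideal R :=
  Ideal.span (Set.range (subPf M))

/-- A matrix is alternating: skew-symmetric with zero diagonal. -/
def IsAlternating {R : Type} [CommRing R] {m : ℕ} (M : Matrix (Fin m) (Fin m) R) : Prop :=
  M.transpose = -M ∧ ∀ i, M i i = 0

/-- The "trimmed" ideal `(Pf_j(M) : j ≠ i₀) + J · (Pf_{i₀}(M))`. -/
def trimPf {R : Type} [CommRing R] {m : ℕ}
    (M : Matrix (Fin (2 * m + 1)) (Fin (2 * m + 1)) R)
    (i₀ : Fin (2 * m + 1)) (J : Ideal R) : Ideal R :=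
  Ideal.span {p | ∃ j ≠ i₀, p = subPf M j} ⊔ J * Ideal.span {subPf M i₀}

/-- Elementwise form of `[a, b, c]` being a weakly regular sequence on the ring. -/
structure IsWeaklyRegularTriple {R : Type*} [CommRing R] (a b c : R) : Prop where
  fst : ∀ z, a * z = 0 → z = 0
  snd : ∀ z u, b * z = a * u → ∃ t, z = a * t
  trd : ∀ z u v, c * z = a * u + b * v → ∃ s t, z = a * s + b * t

lemma smul_mem_ofList_iff {R : Type*} [CommRing R] (l : List R) (z : R) :
    z ∈ (Ideal.ofList l • ⊤ : Submodule R R) ↔ z ∈ Ideal.ofList l := by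
  simp

lemma isSMulRegular_quotient_iff {R : Type*} [CommRing R] (I : Submodule R R) (r : R) :
    IsSMulRegular (R ⧸ I) r ↔ ∀ z, r * z ∈ I → z ∈ I := by
  rw [isSMulRegular_quotient_iff_mem_of_smul_mem]
  rfl

lemma isWeaklyRegular_triple_iff {R : Type*} [CommRing R] (a b c : R) :
    RingTheory.Sequence.IsWeaklyRegular R [a, b, c] ↔ IsWeaklyRegularTriple a b c := by
  have hpair (z : R) : z ∈ Ideal.ofList [a, b] ↔ ∃ s t, z = a * s + b * t := by
    simp only [Ideal.ofList_cons, Ideal.ofList_nil, Submodule.mem_sup,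
      Ideal.mem_span_singleton']
    constructor
    · rintro ⟨_, ⟨s, rfl⟩, _, ⟨_, ⟨t, rfl⟩, z, hz, rfl⟩, rfl⟩
      rw [Ideal.mem_bot] at hz
      exact ⟨s, t, by rw [hz]; ring⟩
    · rintro ⟨s, t, rfl⟩
      exact ⟨_, ⟨s, rfl⟩, _, ⟨_, ⟨t, rfl⟩, 0, Ideal.zero_mem _, rfl⟩, by ring⟩
  have hsingle (z : R) : z ∈ Ideal.ofList [a] ↔ ∃ s, z = a * s := by
    rw [Ideal.ofList_singleton, Ideal.mem_span_singleton]; rfl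
  have hnil (z : R) : z ∈ Ideal.ofList ([] : List R) ↔ z = 0 := by
    simp
  rw [RingTheory.Sequence.isWeaklyRegular_iff_Fin]
  simp only [isSMulRegular_quotient_iff, smul_mem_ofList_iff]
  have : (∀ (i : Fin [a, b, c].length) (z : R), [a, b, c][i] * z ∈ Ideal.ofList ([a, b, c].take i)
      → z ∈ Ideal.ofList ([a, b, c].take i)) ↔
      (∀ z, a * z ∈ Ideal.ofList ([] : List R) → z ∈ Ideal.ofList ([] : List R)) ∧
      (∀ z, b * z ∈ Ideal.ofList [a] → z ∈ Ideal.ofList [a]) ∧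
      (∀ z, c * z ∈ Ideal.ofList [a, b] → z ∈ Ideal.ofList [a, b]) := by
    refine ⟨fun h => ⟨h 0, h 1, h 2⟩, fun h i => ?_⟩
    match i with
    | 0 => exact h.1
    | 1 => exact h.2.1
    | 2 => exact h.2.2
  rw [this]
  simp only [hnil, hsingle, hpair]
  exact ⟨fun ⟨h1, h2, h3⟩ => ⟨h1, fun z u h => h2 z ⟨u, h⟩, fun z u v h => h3 z ⟨u, v, h⟩⟩,
    fun ⟨h1, h2, h3⟩ => ⟨h1, fun z ⟨u, h⟩ => h2 z u h, fun z ⟨u, v, h⟩ => h3 z u v h⟩⟩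

lemma exists_isWeaklyRegularTriple {R : Type} [CommRing R] {I : Ideal R} (hI : gradeGE I 3) :
    ∃ a ∈ I, ∃ b ∈ I, ∃ c ∈ I, IsWeaklyRegularTriple a b c := by
  obtain ⟨l, hl, hm, hr⟩ := hI
  obtain ⟨a, b, c, rfl⟩ := List.length_eq_three.mp hl
  exact ⟨a, hm a (by simp), b, hm b (by simp), c, hm c (by simp),
    (isWeaklyRegular_triple_iff a b c).mp hr.toIsWeaklyRegular⟩

lemma gradeGE_of_triple {R : Type} [CommRing R] {I : Ideal R} (hI : I ≠ ⊤) {a b c : R}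
    (ha : a ∈ I) (hb : b ∈ I) (hc : c ∈ I) (h : IsWeaklyRegularTriple a b c) : gradeGE I 3 := by
  have hm : ∀ r ∈ [a, b, c], r ∈ I := by simp [ha, hb, hc]
  refine ⟨[a, b, c], rfl, hm, (isWeaklyRegular_triple_iff a b c).mpr h, fun htop => hI ?_⟩
  rw [eq_top_iff]
  intro z hz
  rw [htop] at hz
  exact (Ideal.span_le.mpr hm) ((smul_mem_ofList_iff _ _).mp hz)

lemma gradeGE_mono {R : Type} [CommRing R] {I J : Ideal R} (h : I ≤ J) {m : ℕ}
    (hI : gradeGE I m) : gradeGE J m := by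
  obtain ⟨l, hl, hm, hr⟩ := hI
  exact ⟨l, hl, fun r hr => h (hm r hr), hr⟩

section Acyclicity

variable {R : Type*} [CommRing R] {F₁ F₂ : Type*} [AddCommGroup F₁] [Module R F₁]
  [AddCommGroup F₂] [Module R F₂] {a b c : R}

/-- If `a` and `b` annihilate the class of `z` modulo the image of an injective map from `R`,
then `z` lies in that image. -/
lemma IsWeaklyRegularTriple.mem_range_of_injective (h : IsWeaklyRegularTriple a b c)
    (hF₂ : ∀ z : F₂, a • z = 0 → z = 0) {d₃ : R →ₗ[R] F₂} (hd₃ : Function.Injective d₃)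
    {z : F₂} (ha : a • z ∈ LinearMap.range d₃) (hb : b • z ∈ LinearMap.range d₃) :
    z ∈ LinearMap.range d₃ := by
  obtain ⟨w, hw⟩ := ha
  obtain ⟨w', hw'⟩ := hb
  obtain ⟨t, rfl⟩ := h.snd w w' (hd₃ (by
    rw [← smul_eq_mul, ← smul_eq_mul, map_smul, map_smul, hw, hw', smul_comm]))
  refine ⟨t, sub_eq_zero.mp (hF₂ _ ?_)⟩
  rw [smul_sub, ← hw, ← map_smul, smul_eq_mul, sub_self]

/-- If `a`, `b` and `c` annihilate the class of `z` modulo the image of a map whose kernel is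
free of rank one, then `z` lies in that image. -/
lemma IsWeaklyRegularTriple.mem_range_of_ker (h : IsWeaklyRegularTriple a b c)
    (hF₂ : ∀ z u : F₂, b • z = a • u → ∃ t, z = a • t)
    (hF₁ : ∀ z : F₁, a • z = 0 → z = 0) {d₃ : R →ₗ[R] F₂} (hd₃ : Function.Injective d₃)
    {d₂ : F₂ →ₗ[R] F₁} (hd₂ : LinearMap.ker d₂ = LinearMap.range d₃)
    {z : F₁} (ha : a • z ∈ LinearMap.range d₂) (hb : b • z ∈ LinearMap.range d₂)
    (hc : c • z ∈ LinearMap.range d₂) : z ∈ LinearMap.range d₂ := by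
  obtain ⟨w, hw⟩ := ha
  obtain ⟨w', hw'⟩ := hb
  obtain ⟨w'', hw''⟩ := hc
  have key (r s : R) (u v : F₂) (hu : d₂ u = r • z) (hv : d₂ v = s • z) :
      ∃ t, d₃ t = s • u - r • v := by
    change s • u - r • v ∈ LinearMap.range d₃
    rw [← hd₂, LinearMap.mem_ker, map_sub, map_smul, map_smul, hu, hv, smul_comm, sub_self]
  obtain ⟨t, ht⟩ := key a b w w' hw hw'
  obtain ⟨t', ht'⟩ := key a c w w'' hw hw''
  obtain ⟨t'', ht''⟩ := key b c w' w'' hw' hw''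
  have hrel : c * t = a * (-t'') + b * t' := by
    apply hd₃
    rw [map_add, ← smul_eq_mul, ← smul_eq_mul, ← smul_eq_mul, map_smul, map_smul, map_smul,
      map_neg, ht, ht', ht'']
    module
  obtain ⟨p, q, hpq⟩ := h.trd t _ _ hrel
  have hd₃₂ (r : R) : d₂ (d₃ r) = 0 := by
    rw [← LinearMap.mem_ker, hd₂]; exact ⟨r, rfl⟩
  have hbw : b • (w - d₃ q) = a • (w' + d₃ p) := by
    have h1 : d₃ t = a • d₃ p + b • d₃ q := by
      rw [hpq, map_add, ← smul_eq_mul, ← smul_eq_mul, map_smul, map_smul]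
    rw [smul_sub, smul_add, sub_eq_iff_eq_add, add_assoc, ← h1, ht]
    abel
  obtain ⟨u, hu⟩ := hF₂ _ _ hbw
  refine ⟨u, sub_eq_zero.mp (hF₁ _ ?_)⟩
  rw [smul_sub, ← map_smul, ← hu, map_sub, hd₃₂, sub_zero, hw, sub_self]

/-- An ideal containing a weakly regular triple is not contained in the annihilator of any nonzero
element of the ring. -/
lemma IsWeaklyRegularTriple.eq_zero (h : IsWeaklyRegularTriple a b c) {I : Ideal R} (ha : a ∈ I)
    (z : R) (hz : ∀ r ∈ I, r * z ∈ (⊥ : Ideal R)) : z ∈ (⊥ : Ideal R) :=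
  h.fst z (hz a ha)

lemma IsWeaklyRegularTriple.mem_span_singleton (h : IsWeaklyRegularTriple a b c) {I : Ideal R}
    (ha : a ∈ I) (hb : b ∈ I) {x : R} (hx : ∀ z, x * z = 0 → z = 0)
    (z : R) (hz : ∀ r ∈ I, r * z ∈ Ideal.span {x}) : z ∈ Ideal.span {x} := by
  have hr (r : R) : r ∈ LinearMap.range (LinearMap.mulLeft R x) ↔ r ∈ Ideal.span {x} := by
    simp only [LinearMap.mem_range, LinearMap.mulLeft_apply, Ideal.mem_span_singleton]
    exact ⟨fun ⟨y, hy⟩ => ⟨y, hy.symm⟩, fun ⟨y, hy⟩ => ⟨y, hy.symm⟩⟩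
  rw [← hr]
  refine h.mem_range_of_injective h.fst ?_ ((hr _).mpr (hz a ha)) ((hr _).mpr (hz b hb))
  exact (injective_iff_map_eq_zero (LinearMap.mulLeft R x)).mpr hx

lemma IsWeaklyRegularTriple.mem_span_pair (h : IsWeaklyRegularTriple a b c) {I : Ideal R}
    (ha : a ∈ I) (hb : b ∈ I) (hc : c ∈ I) {x y : R} (hx : ∀ z, x * z = 0 → z = 0)
    (hy : ∀ z u, y * z = x * u → ∃ t, z = x * t)
    (z : R) (hz : ∀ r ∈ I, r * z ∈ Ideal.span {x, y}) : z ∈ Ideal.span {x, y} := by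
  let d₂ : R × R →ₗ[R] R := (LinearMap.mulLeft R x).coprod (LinearMap.mulLeft R y)
  let d₃ : R →ₗ[R] R × R := (LinearMap.mulLeft R y).prod (-LinearMap.mulLeft R x)
  have hr (r : R) : r ∈ LinearMap.range d₂ ↔ r ∈ Ideal.span {x, y} := by
    simp only [d₂, LinearMap.mem_range, Ideal.mem_span_pair, LinearMap.coprod_apply, Prod.exists,
      LinearMap.mulLeft_apply, mul_comm]
  rw [← hr]
  refine h.mem_range_of_ker (d₃ := d₃) ?_ h.fst ?_ ?_ ((hr _).mpr (hz a ha))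
    ((hr _).mpr (hz b hb)) ((hr _).mpr (hz c hc))
  · rintro ⟨z₁, z₂⟩ ⟨u₁, u₂⟩ hzu
    simp only [Prod.smul_mk, Prod.mk.injEq, smul_eq_mul] at hzu
    obtain ⟨t₁, rfl⟩ := h.snd _ _ hzu.1
    obtain ⟨t₂, rfl⟩ := h.snd _ _ hzu.2
    exact ⟨(t₁, t₂), rfl⟩
  · refine (injective_iff_map_eq_zero d₃).mpr fun t ht => hx t ?_
    simpa [d₃] using congrArg Prod.snd ht
  · ext ⟨u, v⟩
    have h₃ (t : R) : d₃ t = (y * t, -(x * t)) := rfl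
    have h₂ : d₂ (u, v) = x * u + y * v := rfl
    simp only [LinearMap.mem_ker, LinearMap.mem_range, h₂, h₃, Prod.mk.injEq]
    constructor
    · intro huv
      obtain ⟨t, rfl⟩ := hy v (-u) (by linear_combination huv)
      refine ⟨-t, ?_, by ring⟩
      have := hx (u + y * t) (by linear_combination huv)
      linear_combination -this
    · rintro ⟨t, rfl, rfl⟩
      ring

end Acyclicity

section Grade

variable {R : Type} [CommRing R] [IsNoetherianRing R]

/-- Prime avoidance: if no nonzero element of `R ⧸ K` is annihilated by `L`, then `L` contains a
nonzerodivisor on `R ⧸ K`. -/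
lemma exists_mem_forall_mul_mem {K L : Ideal R} (h : ∀ z, (∀ r ∈ L, r * z ∈ K) → z ∈ K) :
    ∃ r ∈ L, ∀ z, r * z ∈ K → z ∈ K := by
  by_contra! hcon
  have hsub : (L : Set R) ⊆ ⋃ p ∈ associatedPrimes R (R ⧸ K), (p : Set R) := by
    rw [biUnion_associatedPrimes_eq_compl_regular]
    intro r hr hreg
    obtain ⟨z, hz, hz'⟩ := hcon r hr
    exact hz' ((isSMulRegular_quotient_iff K r).mp hreg z hz)
  obtain ⟨p, hp, hLp⟩ := (L.subset_union_prime_finite (associatedPrimes.finite R (R ⧸ K))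
    (f := id) 0 0 fun _ h _ _ => h.isPrime).mp hsub
  obtain ⟨hprime, y, rfl⟩ := (isAssociatedPrime_iff).mp hp
  obtain ⟨z, rfl⟩ := Ideal.Quotient.mk_surjective y
  refine hprime.ne_top ((Ideal.eq_top_iff_one _).mpr ?_)
  have hz : z ∈ K := h z fun r hr => by
    have := hLp hr
    rw [id, Submodule.mem_colon_singleton, Submodule.mem_bot, Algebra.smul_def] at this
    exact Ideal.Quotient.eq_zero_iff_mem.mp this
  rw [Submodule.mem_colon_singleton, Ideal.Quotient.eq_zero_iff_mem.mpr hz, smul_zero]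
  exact Submodule.zero_mem _

lemma exists_mem_mul_forall_mul_mem {I J K : Ideal R}
    (hI : ∀ z, (∀ r ∈ I, r * z ∈ K) → z ∈ K) (hJ : ∀ z, (∀ r ∈ J, r * z ∈ K) → z ∈ K) :
    ∃ r ∈ I * J, ∀ z, r * z ∈ K → z ∈ K :=
  exists_mem_forall_mul_mem fun z hz => hI z fun r hr => hJ _ fun s hs => by
    rw [← mul_assoc, mul_comm s]
    exact hz _ (Ideal.mul_mem_mul hr hs)

lemma exists_isWeaklyRegularTriple_mul {I J : Ideal R} (hI : gradeGE I 3) (hJ : gradeGE J 3) :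
    ∃ a ∈ I * J, ∃ b ∈ I * J, ∃ c ∈ I * J, IsWeaklyRegularTriple a b c := by
  obtain ⟨a, ha, b, hb, c, hc, habc⟩ := exists_isWeaklyRegularTriple hI
  obtain ⟨a', ha', b', hb', c', hc', habc'⟩ := exists_isWeaklyRegularTriple hJ
  obtain ⟨x, hx, hx0⟩ := exists_mem_mul_forall_mul_mem (habc.eq_zero ha) (habc'.eq_zero ha')
  obtain ⟨y, hy, hy0⟩ := exists_mem_mul_forall_mul_mem
    (habc.mem_span_singleton ha hb hx0) (habc'.mem_span_singleton ha' hb' hx0)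
  have hxy (z u : R) (hzu : y * z = x * u) : ∃ t, z = x * t :=
    Ideal.mem_span_singleton.mp (hy0 z (Ideal.mem_span_singleton.mpr ⟨u, hzu⟩))
  obtain ⟨w, hw, hw0⟩ := exists_mem_mul_forall_mul_mem
    (habc.mem_span_pair ha hb hc hx0 hxy) (habc'.mem_span_pair ha' hb' hc' hx0 hxy)
  refine ⟨x, hx, y, hy, w, hw, hx0, hxy, fun z u v hz => ?_⟩
  obtain ⟨s, t, hst⟩ := Ideal.mem_span_pair.mp
    (hw0 z (Ideal.mem_span_pair.mpr ⟨u, v, by rw [hz]; ring⟩))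
  exact ⟨s, t, by rw [← hst]; ring⟩

end Grade

section Exactness

open scoped Matrix

variable {R : Type*} [CommRing R] {ι : Type*} {p : ι → R} {a b c : R}

lemma mem_of_mem_span_range {M : Type*} [AddCommGroup M] [Module R M] {N : Submodule R M} {z : M}
    (h : ∀ i, p i • z ∈ N) {r : R} (hr : r ∈ Ideal.span (Set.range p)) : r • z ∈ N := by
  have : Ideal.span (Set.range p) ≤ N.comap (LinearMap.toSpanSingleton R M z) := by
    rw [Ideal.span_le]
    rintro _ ⟨i, rfl⟩
    exact h i
  exact this hr

lemma IsWeaklyRegularTriple.eq_zero_of_forall_mul (h : IsWeaklyRegularTriple a b c)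
    (ha : a ∈ Ideal.span (Set.range p)) {r : R} (hr : ∀ i, r * p i = 0) : r = 0 := by
  have := mem_of_mem_span_range (N := (⊥ : Submodule R R)) (z := r)
    (fun i => by rw [smul_eq_mul, mul_comm, hr, Submodule.mem_bot]) ha
  exact h.fst r this

lemma IsWeaklyRegularTriple.toSpanSingleton_injective (h : IsWeaklyRegularTriple a b c)
    (ha : a ∈ Ideal.span (Set.range p)) :
    Function.Injective (LinearMap.toSpanSingleton R (ι → R) p) :=
  (injective_iff_map_eq_zero _).mpr fun _ hr =>
    h.eq_zero_of_forall_mul ha fun i => congrFun hr i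

lemma IsWeaklyRegularTriple.smul_pi (h : IsWeaklyRegularTriple a b c) (z : ι → R)
    (hz : a • z = 0) : z = 0 :=
  funext fun i => h.fst _ (congrFun hz i)

lemma IsWeaklyRegularTriple.exists_smul_pi (h : IsWeaklyRegularTriple a b c) (z u : ι → R)
    (hz : b • z = a • u) : ∃ t, z = a • t := by
  choose t ht using fun i => h.snd (z i) (u i) (congrFun hz i)
  exact ⟨t, funext ht⟩

variable [Fintype ι] [DecidableEq ι]

/-- The data making `0 → R → R^ι → R^ι → R` with differentials `p`, `A`, `pᵀ` a complex whose
homology is annihilated by the entries of `p`: the matrices `T i` are homotopies for `p i`. -/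
structure IsHomotopyData (A : Matrix ι ι R) (p : ι → R) (T : ι → Matrix ι ι R) : Prop where
  transpose_eq : Aᵀ = -A
  mulVec_eq_zero : A *ᵥ p = 0
  mul_eq : ∀ i, A * T i = Matrix.vecMulVec (Pi.single i 1) p - p i • 1
  eq_mul : ∀ i, T i * A = Matrix.vecMulVec p (Pi.single i 1) - p i • 1

variable {A : Matrix ι ι R} {T : ι → Matrix ι ι R}

namespace IsHomotopyData

variable (hA : IsHomotopyData A p T) (h : IsWeaklyRegularTriple a b c)
  (ha : a ∈ Ideal.span (Set.range p)) (hb : b ∈ Ideal.span (Set.range p))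
  (hc : c ∈ Ideal.span (Set.range p))

include hA in
lemma dotProduct_mulVec_eq_zero (v : ι → R) : p ⬝ᵥ A *ᵥ v = 0 := by
  rw [Matrix.dotProduct_mulVec, ← Matrix.mulVec_transpose, hA.transpose_eq, Matrix.neg_mulVec,
    hA.mulVec_eq_zero, neg_zero, zero_dotProduct]

include hA h ha hb in
lemma exact_mulVec {v : ι → R} (hv : A *ᵥ v = 0) : ∃ r : R, v = r • p := by
  have key (i : ι) : p i • v ∈ LinearMap.range (LinearMap.toSpanSingleton R (ι → R) p) := by
    have := congrArg (T i *ᵥ ·) hv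
    simp only [Matrix.mulVec_mulVec, hA.eq_mul, Matrix.sub_mulVec, Matrix.mulVec_zero,
      Matrix.smul_mulVec, Matrix.one_mulVec, sub_eq_zero] at this
    refine ⟨v i, ?_⟩
    rw [← this]
    ext j
    simp [Matrix.vecMulVec_mulVec, mul_comm]
  obtain ⟨r, hr⟩ := h.mem_range_of_injective h.smul_pi (h.toSpanSingleton_injective ha)
    (mem_of_mem_span_range key ha) (mem_of_mem_span_range key hb)
  exact ⟨r, hr.symm⟩

include hA h ha hb hc in
lemma exact_dotProduct {v : ι → R} (hv : p ⬝ᵥ v = 0) : ∃ w, v = A *ᵥ w := by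
  have key (i : ι) : p i • v ∈ LinearMap.range A.mulVecLin := by
    refine ⟨-(T i *ᵥ v), ?_⟩
    rw [Matrix.mulVecLin_apply, Matrix.mulVec_neg, Matrix.mulVec_mulVec, hA.mul_eq,
      Matrix.sub_mulVec, Matrix.vecMulVec_mulVec, hv, Matrix.smul_mulVec, Matrix.one_mulVec]
    simp
  have hker : LinearMap.ker A.mulVecLin =
      LinearMap.range (LinearMap.toSpanSingleton R (ι → R) p) := by
    ext v
    rw [LinearMap.mem_ker, Matrix.mulVecLin_apply]
    constructor
    · intro hv
      obtain ⟨r, hr⟩ := hA.exact_mulVec h ha hb hv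
      exact ⟨r, hr.symm⟩
    · rintro ⟨r, rfl⟩
      rw [LinearMap.toSpanSingleton_apply, Matrix.mulVec_smul, hA.mulVec_eq_zero, smul_zero]
  obtain ⟨w, hw⟩ := h.mem_range_of_ker h.exists_smul_pi h.smul_pi
    (h.toSpanSingleton_injective ha) hker (mem_of_mem_span_range key ha)
    (mem_of_mem_span_range key hb) (mem_of_mem_span_range key hc)
  exact ⟨w, hw.symm⟩

end IsHomotopyData

/-- The matrix of the cross product with `x`. -/
def crossMatrix (x : Fin 3 → R) : Matrix (Fin 3) (Fin 3) R :=
  !![0, -x 2, x 1; x 2, 0, -x 0; -x 1, x 0, 0]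

lemma isHomotopyData_crossMatrix (x : Fin 3 → R) :
    IsHomotopyData (crossMatrix x) x fun i => crossMatrix (Pi.single i 1) where
  transpose_eq := by
    ext i j
    fin_cases i <;> fin_cases j <;> simp [crossMatrix]
  mulVec_eq_zero := by
    ext i
    fin_cases i <;> simp [crossMatrix, Matrix.mulVec, dotProduct, Fin.sum_univ_three] <;> ring
  mul_eq i := by
    ext j k
    fin_cases i <;> fin_cases j <;> fin_cases k <;>
      simp [crossMatrix, Matrix.mul_apply, Fin.sum_univ_three, Matrix.vecMulVec]
  eq_mul i := by
    ext j k
    fin_cases i <;> fin_cases j <;> fin_cases k <;>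
      simp [crossMatrix, Matrix.mul_apply, Fin.sum_univ_three, Matrix.vecMulVec]

end Exactness

section Pfaffian

open scoped Matrix

open CliffordAlgebra (contractLeft changeForm)

variable {R : Type} [CommRing R]

section BilinForm

variable {V : Type*} [AddCommGroup V] [Module R V]

lemma contractLeft_ιMulti (d : Module.Dual R V) {m : ℕ} (v : Fin (m + 1) → V) :
    contractLeft (Q := (0 : QuadraticForm R V)) d (ExteriorAlgebra.ιMulti R (m + 1) v) =
      ∑ i : Fin (m + 1), ((-1 : R) ^ (i : ℕ) * d (v i)) • ExteriorAlgebra.ιMulti R m (v ∘ i.succAbove) := by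
  induction m with
  | zero =>
    rw [ExteriorAlgebra.ιMulti_succ_apply, ExteriorAlgebra.ιMulti_zero_apply, mul_one]
    simp [ExteriorAlgebra.ι, Algebra.algebraMap_eq_smul_one]
  | succ m ih =>
    rw [ExteriorAlgebra.ιMulti_succ_apply]
    refine (CliffordAlgebra.contractLeft_ι_mul _ _ _).trans ?_
    rw [ih, Finset.mul_sum, Fin.sum_univ_succ (n := m + 1), sub_eq_add_neg, ← Finset.sum_neg_distrib]
    congr 1
    · simp; rfl
    · refine Finset.sum_congr rfl fun i _ => ?_
      rw [ExteriorAlgebra.ιMulti_succ_apply (v ∘ _), mul_smul_comm, ← neg_smul]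
      congr 1
      · simp [Matrix.vecTail, pow_succ]
      · congr 1
        congr 1
        ext j
        simp [Matrix.vecTail]

variable (B : LinearMap.BilinForm R V) (hB : B.IsAlt)

lemma toQuadraticMap_eq_zero_sub_zero {B : LinearMap.BilinForm R V} (hB : B.IsAlt) :
    B.toQuadraticMap = (0 : QuadraticForm R V) - 0 := by
  ext v
  simpa using hB v

/-- The functional on the exterior algebra whose value on `v₁ ∧ ⋯ ∧ v₂ₘ` is, up to sign, the
Pfaffian of the matrix `B vᵢ vⱼ`. -/
def pfaffianForm {B : LinearMap.BilinForm R V} (hB : B.IsAlt) : ExteriorAlgebra R V →ₗ[R] R :=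
  (ExteriorAlgebra.algebraMapInv (R := R) (M := V)).toLinearMap ∘ₗ
    changeForm (toQuadraticMap_eq_zero_sub_zero hB)

variable {B}

lemma pfaffianForm_one : pfaffianForm hB 1 = 1 := by
  simp only [pfaffianForm, LinearMap.comp_apply, AlgHom.toLinearMap_apply]
  rw [CliffordAlgebra.changeForm_one]
  exact map_one _

lemma pfaffianForm_ι_mul (v : V) (y : ExteriorAlgebra R V) :
    pfaffianForm hB (ExteriorAlgebra.ι R v * y) =
      -pfaffianForm hB (contractLeft (Q := (0 : QuadraticForm R V)) (B v) y) := by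
  simp only [pfaffianForm, LinearMap.comp_apply, AlgHom.toLinearMap_apply]
  rw [CliffordAlgebra.changeForm_contractLeft]
  have := CliffordAlgebra.changeForm_ι_mul (toQuadraticMap_eq_zero_sub_zero hB) v y
  refine (congrArg _ this).trans ?_
  rw [map_sub]
  have h0 (z : ExteriorAlgebra R V) :
      ExteriorAlgebra.algebraMapInv (R := R) (M := V) (ExteriorAlgebra.ι R v * z) = 0 := by
    rw [map_mul]
    simp [ExteriorAlgebra.algebraMapInv]
  exact (congrArg (· - _) (h0 _)).trans (zero_sub _)

lemma pfaffianForm_ιMulti (m : ℕ) (v : Fin (2 * m) → V) :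
    pfaffianForm hB (ExteriorAlgebra.ιMulti R (2 * m) v) =
      (-1) ^ m * pfAux m (Matrix.of fun i j => B (v i) (v j)) := by
  induction m with
  | zero =>
    rw [ExteriorAlgebra.ιMulti_zero_apply, pfaffianForm_one]
    simp [pfAux]
  | succ m ih =>
    change pfaffianForm hB (ExteriorAlgebra.ιMulti R (2 * m + 1 + 1) v) = _
    rw [ExteriorAlgebra.ιMulti_succ_apply, pfaffianForm_ι_mul, contractLeft_ιMulti, map_sum,
      pfAux, Finset.mul_sum, ← Finset.sum_neg_distrib]
    refine Finset.sum_congr rfl fun j _ => ?_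
    rw [map_smul, ih, smul_eq_mul, pow_succ]
    simp only [Matrix.submatrix, Matrix.of_apply, Matrix.vecTail, Function.comp_def]
    ring

end BilinForm

variable {n : ℕ} {M : Matrix (Fin (2 * n + 1)) (Fin (2 * n + 1)) R}

lemma IsAlternating.isAlt_toBilin' {m : ℕ} {A : Matrix (Fin m) (Fin m) R} (hA : IsAlternating A) :
    (Matrix.toBilin' A).IsAlt := by
  intro v
  rw [Matrix.toBilin'_apply, ← Fintype.sum_prod_type']
  refine Finset.sum_involution (fun x _ => x.swap) ?_ ?_ (by simp) (by simp)
  · rintro ⟨i, j⟩ -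
    have : A j i = -A i j := congrFun₂ hA.1 i j
    simp only [Prod.swap, this]
    ring
  · rintro ⟨i, j⟩ - h heq
    obtain rfl : j = i := congrArg Prod.fst heq
    simp [hA.2] at h

/-- Up to a common sign, the signed submaximal Pfaffians of an alternating matrix of odd size. -/
def signedPf (M : Matrix (Fin (2 * n + 1)) (Fin (2 * n + 1)) R) (j : Fin (2 * n + 1)) : R :=
  (-1) ^ (n + j : ℕ) * subPf M j

variable (hM : IsAlternating M)

/-- The `j`-th coordinate functional, contracted into the exterior algebra of `R^m`. -/
def coordContract {m : ℕ} (j : Fin m) :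
    ExteriorAlgebra R (Fin m → R) →ₗ[R] ExteriorAlgebra R (Fin m → R) :=
  contractLeft (Q := (0 : QuadraticForm R (Fin m → R))) (LinearMap.proj j)

lemma coordContract_comm {m : ℕ} (i j : Fin m) (y : ExteriorAlgebra R (Fin m → R)) :
    coordContract i (coordContract j y) = -coordContract j (coordContract i y) :=
  CliffordAlgebra.contractLeft_comm (Q := (0 : QuadraticForm R (Fin m → R))) (LinearMap.proj i)
    (LinearMap.proj j) y

lemma ι_single_mul_coordContract {m : ℕ} (i j : Fin m) (y : ExteriorAlgebra R (Fin m → R)) :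
    ExteriorAlgebra.ι R (Pi.single i 1) * coordContract j y =
      (Pi.single i 1 : Fin m → R) j • y -
        coordContract j (ExteriorAlgebra.ι R (Pi.single i 1) * y) := by
  refine eq_sub_of_add_eq' (eq_sub_iff_add_eq.mp ?_)
  exact CliffordAlgebra.contractLeft_ι_mul _ _ _

lemma sum_mul_pfaffianForm_coordContract {m : ℕ} {A : Matrix (Fin m) (Fin m) R}
    (hA : IsAlternating A) (l : Fin m) (y : ExteriorAlgebra R (Fin m → R)) :
    ∑ k, A l k * pfaffianForm hA.isAlt_toBilin' (coordContract k y) =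
      -pfaffianForm hA.isAlt_toBilin' (ExteriorAlgebra.ι R (Pi.single l 1) * y) := by
  rw [pfaffianForm_ι_mul, neg_neg]
  have : Matrix.toBilin' A (Pi.single l 1) =
      ∑ k, A l k • (LinearMap.proj k : (Fin m → R) →ₗ[R] R) := by
    ext k
    simp [Matrix.toBilin'_single, Pi.single_apply]
  rw [this, map_sum, LinearMap.sum_apply, map_sum]
  refine Finset.sum_congr rfl fun k _ => ?_
  rw [map_smul, LinearMap.smul_apply, map_smul]
  rfl

/-- The top exterior power of the standard basis. -/
def topForm (R : Type) [CommRing R] (m : ℕ) : ExteriorAlgebra R (Fin m → R) :=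
  ExteriorAlgebra.ιMulti R m fun i => Pi.single i 1

lemma ι_single_mul_topForm {m : ℕ} (l : Fin m) :
    ExteriorAlgebra.ι R (Pi.single l 1) * topForm R m = 0 := by
  have := ExteriorAlgebra.ιMulti_succ_apply (R := R)
    (Fin.cons (Pi.single l 1) fun i : Fin m => (Pi.single i 1 : Fin m → R))
  refine Eq.trans this.symm (ExteriorAlgebra.ιMulti_eq_zero_of_not_inj fun hinj => ?_)
  exact Fin.succ_ne_zero l (hinj (by simp))

lemma pfaffianForm_coordContract_topForm (j : Fin (2 * n + 1)) :
    pfaffianForm hM.isAlt_toBilin' (coordContract j (topForm R (2 * n + 1))) = signedPf M j := by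
  refine (congrArg _ (contractLeft_ιMulti _ _)).trans ?_
  rw [Finset.sum_eq_single j, map_smul, pfaffianForm_ιMulti, signedPf, subPf]
  · simp only [Function.comp_apply, Matrix.toBilin'_single, LinearMap.proj_apply,
      Pi.single_eq_same, smul_eq_mul, mul_one, pow_add]
    rw [← mul_assoc, mul_comm ((-1 : R) ^ n)]
    rfl
  · intro i _ hi
    simp [Pi.single_eq_of_ne hi.symm]
  · simp

/-- The signed Pfaffians of order `2n - 2` of an alternating matrix of size `2n + 1`. -/
def submaximalHomotopy (hM : IsAlternating M) (i : Fin (2 * n + 1)) :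
    Matrix (Fin (2 * n + 1)) (Fin (2 * n + 1)) R :=
  Matrix.of fun k j => pfaffianForm hM.isAlt_toBilin'
    (coordContract k (coordContract j (coordContract i (topForm R (2 * n + 1)))))

lemma mul_submaximalHomotopy (i : Fin (2 * n + 1)) :
    M * submaximalHomotopy hM i =
      Matrix.vecMulVec (Pi.single i 1) (signedPf M) - signedPf M i • 1 := by
  ext l j
  rw [Matrix.mul_apply]
  simp only [submaximalHomotopy, Matrix.of_apply]
  rw [sum_mul_pfaffianForm_coordContract hM, ι_single_mul_coordContract, ι_single_mul_coordContract,
    ι_single_mul_topForm]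
  simp only [map_zero, sub_zero, map_smul, map_sub, pfaffianForm_coordContract_topForm hM,
    Matrix.sub_apply, Matrix.vecMulVec_apply, Matrix.smul_apply, Matrix.one_apply,
    Pi.single_apply, smul_eq_mul, mul_one, mul_ite, ite_mul, neg_sub]
  simp only [eq_comm, one_mul, zero_mul, mul_zero]

lemma transpose_submaximalHomotopy (i : Fin (2 * n + 1)) :
    (submaximalHomotopy hM i)ᵀ = -submaximalHomotopy hM i := by
  ext k j
  simp only [submaximalHomotopy, Matrix.transpose_apply, Matrix.neg_apply, Matrix.of_apply]
  rw [coordContract_comm, map_neg]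

lemma isHomotopyData_signedPf :
    IsHomotopyData M (signedPf M) (submaximalHomotopy hM) where
  transpose_eq := hM.1
  mulVec_eq_zero := by
    ext l
    simp only [Matrix.mulVec, dotProduct, ← pfaffianForm_coordContract_topForm hM]
    rw [sum_mul_pfaffianForm_coordContract hM, ι_single_mul_topForm, map_zero, neg_zero]
    rfl
  mul_eq := mul_submaximalHomotopy hM
  eq_mul i := by
    have := congrArg Matrix.transpose (mul_submaximalHomotopy hM i)
    rw [Matrix.transpose_mul, transpose_submaximalHomotopy, hM.1, neg_mul_neg] at this
    rw [this, Matrix.transpose_sub, Matrix.transpose_smul, Matrix.transpose_one,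
      Matrix.transpose_vecMulVec]

lemma subPf_eq_mul_signedPf (j : Fin (2 * n + 1)) :
    subPf M j = (-1) ^ (n + j : ℕ) * signedPf M j := by
  rw [signedPf, ← mul_assoc, ← pow_add, Even.neg_one_pow ⟨_, rfl⟩, one_mul]

lemma span_range_signedPf : Ideal.span (Set.range (signedPf M)) = pfIdeal M := by
  refine le_antisymm (Ideal.span_le.mpr ?_) (Ideal.span_le.mpr ?_)
  · rintro _ ⟨j, rfl⟩
    exact Ideal.mul_mem_left _ _ (Ideal.subset_span ⟨j, rfl⟩)
  · rintro _ ⟨j, rfl⟩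
    rw [subPf_eq_mul_signedPf]
    exact Ideal.mul_mem_left _ _ (Ideal.subset_span ⟨j, rfl⟩)

end Pfaffian

section Trimming

open scoped Matrix

variable {R : Type*} [CommRing R] {ι : Type*} [Fintype ι] [DecidableEq ι]
  {A : Matrix ι ι R} {p : ι → R} {T : ι → Matrix ι ι R} {a b c a' b' c' : R}

lemma crossMatrix_mulVec_self (x : Fin 3 → R) : crossMatrix x *ᵥ x = 0 :=
  (isHomotopyData_crossMatrix x).mulVec_eq_zero

/-- The generators of the trimmed ideal: `p i` for `i ≠ i₀` together with `p i₀ * x k`. -/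
def trimGenerators (p : ι → R) (x : Fin 3 → R) (i₀ : ι) :
    (Fin 3 → R) × ({i // i ≠ i₀} → R) →ₗ[R] R where
  toFun u := p i₀ * x ⬝ᵥ u.1 + ∑ i : {i // i ≠ i₀}, p i * u.2 i
  map_add' u v := by
    simp only [Prod.fst_add, Prod.snd_add, dotProduct_add, Pi.add_apply, mul_add,
      Finset.sum_add_distrib]
    ring
  map_smul' r u := by
    simp only [Prod.smul_fst, Prod.smul_snd, dotProduct_smul, Pi.smul_apply, smul_eq_mul,
      RingHom.id_apply, mul_add, Finset.mul_sum, mul_left_comm r]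

/-- The relations among the generators of the trimmed ideal: the rows of `A` other than the
`i₀`-th one, whose entries are replaced by their lifts `Y` along `x`, and the Koszul relations
on `x`. -/
def trimRelations (A : Matrix ι ι R) (x : Fin 3 → R) (Y : Matrix (Fin 3) ι R) (i₀ : ι) :
    (ι → R) × (Fin 3 → R) →ₗ[R] (Fin 3 → R) × ({i // i ≠ i₀} → R) :=
  (Y.mulVecLin.coprod (crossMatrix x).mulVecLin).prod
    (LinearMap.funLeft R R Subtype.val ∘ₗ A.mulVecLin ∘ₗ LinearMap.fst R _ _)

/-- The second syzygies of the trimmed ideal. -/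
def trimSyzygies (p : ι → R) (x z : Fin 3 → R) : R × R →ₗ[R] (ι → R) × (Fin 3 → R) :=
  ((LinearMap.toSpanSingleton R _ p).prod (-LinearMap.toSpanSingleton R _ z)).coprod
    (LinearMap.inr R _ _ ∘ₗ LinearMap.toSpanSingleton R _ x)

omit [DecidableEq ι] in
lemma trimRelations_apply (x : Fin 3 → R) (Y : Matrix (Fin 3) ι R) (i₀ : ι)
    (w : ι → R) (k : Fin 3 → R) :
    trimRelations A x Y i₀ (w, k) =
      (Y *ᵥ w + crossMatrix x *ᵥ k, fun i => (A *ᵥ w) i.1) := rfl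

omit [Fintype ι] [DecidableEq ι] in
lemma trimSyzygies_apply (x z : Fin 3 → R) (r s : R) :
    trimSyzygies p x z (r, s) = (r • p, -(r • z) + s • x) := by
  simp [trimSyzygies]

variable {x : Fin 3 → R} {Y : Matrix (Fin 3) ι R} {i₀ : ι}

omit [Fintype ι] [DecidableEq ι] in
lemma trimSyzygies_injective (z : Fin 3 → R) (h : IsWeaklyRegularTriple a b c)
    (ha : a ∈ Ideal.span (Set.range p)) (h' : IsWeaklyRegularTriple a' b' c')
    (ha' : a' ∈ Ideal.span (Set.range x)) : Function.Injective (trimSyzygies p x z) := by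
  refine (injective_iff_map_eq_zero _).mpr ?_
  rintro ⟨r, s⟩ hrs
  rw [trimSyzygies_apply, Prod.mk_eq_zero] at hrs
  obtain rfl : r = 0 := h.eq_zero_of_forall_mul ha fun i => congrFun hrs.1 i
  obtain rfl : s = 0 := h'.eq_zero_of_forall_mul ha' fun i => by simpa using congrFun hrs.2 i
  rfl

namespace IsHomotopyData

variable (hA : IsHomotopyData A p T)
  (h : IsWeaklyRegularTriple a b c) (ha : a ∈ Ideal.span (Set.range p))
  (hb : b ∈ Ideal.span (Set.range p)) (hc : c ∈ Ideal.span (Set.range p))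
  (h' : IsWeaklyRegularTriple a' b' c') (ha' : a' ∈ Ideal.span (Set.range x))
  (hb' : b' ∈ Ideal.span (Set.range x)) (hc' : c' ∈ Ideal.span (Set.range x))
  (hY : ∀ w, x ⬝ᵥ Y *ᵥ w = (A *ᵥ w) i₀)

include hA h ha hb h' ha' hb' hY in
lemma exact_trimSyzygies {z : Fin 3 → R} (hz : Y *ᵥ p = crossMatrix x *ᵥ z) :
    Function.Exact (trimSyzygies p x z) (trimRelations A x Y i₀) := by
  have hx := isHomotopyData_crossMatrix x
  rintro ⟨w, k⟩
  rw [trimRelations_apply, Prod.mk_eq_zero]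
  constructor
  · rintro ⟨h₁, h₂⟩
    have hw : A *ᵥ w = 0 := by
      ext i
      by_cases hi : i = i₀
      · rw [hi, ← hY, eq_neg_of_add_eq_zero_left h₁, dotProduct_neg,
          hx.dotProduct_mulVec_eq_zero, neg_zero]
        rfl
      · exact congrFun h₂ ⟨i, hi⟩
    obtain ⟨r, rfl⟩ := hA.exact_mulVec h ha hb hw
    have hk : crossMatrix x *ᵥ (k + r • z) = 0 := by
      rw [Matrix.mulVec_add, Matrix.mulVec_smul, ← hz, ← h₁, Matrix.mulVec_smul, add_comm]
    obtain ⟨s, hs⟩ := hx.exact_mulVec h' ha' hb' hk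
    exact ⟨(r, s), by rw [trimSyzygies_apply, ← hs]; simp⟩
  · rintro ⟨⟨r, s⟩, hrs⟩
    rw [trimSyzygies_apply, Prod.mk.injEq] at hrs
    obtain ⟨rfl, rfl⟩ := hrs
    simp only [Matrix.mulVec_add, Matrix.mulVec_neg, Matrix.mulVec_smul, hz,
      crossMatrix_mulVec_self, hA.mulVec_eq_zero, smul_zero, add_zero, add_neg_cancel]
    exact ⟨trivial, rfl⟩

include hA h ha hb hc h' ha' hb' hc' hY in
lemma exact_trimRelations :
    Function.Exact (trimRelations A x Y i₀) (trimGenerators p x i₀) := by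
  have hx := isHomotopyData_crossMatrix x
  rintro ⟨u, v⟩
  constructor
  · intro huv
    let f : ι → R := fun i => if hi : i = i₀ then x ⬝ᵥ u else v ⟨i, hi⟩
    have hf₀ : f i₀ = x ⬝ᵥ u := dif_pos rfl
    have hf (i : {i // i ≠ i₀}) : f i = v i := dif_neg i.2
    have hpf : p ⬝ᵥ f = 0 := by
      rw [dotProduct, Fintype.sum_eq_add_sum_subtype_ne _ i₀, hf₀]
      simp only [hf]
      exact huv
    obtain ⟨w, hw⟩ := hA.exact_dotProduct h ha hb hc hpf
    have hu : x ⬝ᵥ (u - Y *ᵥ w) = 0 := by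
      rw [dotProduct_sub, hY, ← hw, hf₀, sub_self]
    obtain ⟨k, hk⟩ := hx.exact_dotProduct h' ha' hb' hc' hu
    refine ⟨(w, k), ?_⟩
    rw [trimRelations_apply, ← hk, ← hw]
    simp [hf]
  · rintro ⟨⟨w, k⟩, hwk⟩
    rw [trimRelations_apply, Prod.mk.injEq] at hwk
    obtain ⟨rfl, rfl⟩ := hwk
    have := hA.dotProduct_mulVec_eq_zero w
    rw [dotProduct, Fintype.sum_eq_add_sum_subtype_ne _ i₀] at this
    change p i₀ * x ⬝ᵥ (_ + _) + ∑ i : {i // i ≠ i₀}, p i * _ = 0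
    rw [dotProduct_add, hY, hx.dotProduct_mulVec_eq_zero, add_zero, this]

end IsHomotopyData

end Trimming

section TrimmedPfaffians

open scoped Matrix

variable {R : Type} [CommRing R] {n : ℕ} {M : Matrix (Fin (2 * n + 1)) (Fin (2 * n + 1)) R}
  (i₀ : Fin (2 * n + 1)) (J : Ideal R)

variable (M) in
lemma trimPf_le_pfIdeal : trimPf M i₀ J ≤ pfIdeal M := by
  refine sup_le (Ideal.span_le.mpr ?_) (Ideal.mul_le_right.trans ?_)
  · rintro _ ⟨j, -, rfl⟩
    exact Ideal.subset_span ⟨j, rfl⟩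
  · rw [Ideal.span_singleton_le_iff_mem]
    exact Ideal.subset_span ⟨i₀, rfl⟩

variable (M) in
lemma mul_pfIdeal_le_trimPf : J * pfIdeal M ≤ trimPf M i₀ J := by
  rw [pfIdeal, Ideal.mul_le]
  intro r hr s hs
  refine (Ideal.span_le.mpr ?_ :
    _ ≤ Submodule.comap (LinearMap.mulLeft R r) (trimPf M i₀ J)) hs
  rintro _ ⟨j, rfl⟩
  change r * subPf M j ∈ trimPf M i₀ J
  by_cases hj : j = i₀
  · subst hj
    exact Ideal.mem_sup_right (Ideal.mul_mem_mul hr (Ideal.mem_span_singleton_self _))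
  · exact Ideal.mem_sup_left (Ideal.mul_mem_left _ _ (Ideal.subset_span ⟨j, hj, rfl⟩))

lemma dotProduct_apply_single {m : ℕ} (x : (Fin m → R) →ₗ[R] R) (u : Fin m → R) :
    (fun k => x (Pi.single k 1)) ⬝ᵥ u = x u := by
  rw [LinearMap.pi_apply_eq_sum_univ x u, dotProduct]
  refine Finset.sum_congr rfl fun k _ => ?_
  rw [smul_eq_mul, mul_comm]
  congr 2
  ext j
  simp [Pi.single_apply, eq_comm]

lemma range_trimGenerators (x : (Fin 3 → R) →ₗ[R] R) :
    LinearMap.range (trimGenerators (signedPf M) (fun k => x (Pi.single k 1)) i₀) =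
      trimPf M i₀ (LinearMap.range x) := by
  have hd (u : (Fin 3 → R) × ({i // i ≠ i₀} → R)) :
      trimGenerators (signedPf M) (fun k => x (Pi.single k 1)) i₀ u =
        signedPf M i₀ * x u.1 + ∑ i : {i // i ≠ i₀}, signedPf M i * u.2 i := by
    rw [← dotProduct_apply_single x]; rfl
  apply le_antisymm
  · rintro _ ⟨u, rfl⟩
    rw [hd]
    refine Ideal.add_mem _ (Ideal.mem_sup_right ?_)
      (Ideal.mem_sup_left (Ideal.sum_mem _ fun i _ => ?_))
    · rw [mul_comm]
      exact Ideal.mul_mem_mul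
        ((Ideal.span {subPf M i₀}).mul_mem_left _ (Ideal.mem_span_singleton_self _))
        (LinearMap.mem_range_self x u.1)
    · exact Ideal.mul_mem_right _ _ (Ideal.mul_mem_left _ _ (Ideal.subset_span ⟨i, i.2, rfl⟩))
  · refine sup_le (Ideal.span_le.mpr ?_) (Ideal.mul_le.mpr ?_)
    · rintro _ ⟨j, hj, rfl⟩
      refine ⟨(0, Pi.single ⟨j, hj⟩ ((-1) ^ (n + j : ℕ))), ?_⟩
      rw [hd, map_zero, mul_zero, zero_add, Finset.sum_eq_single ⟨j, hj⟩]
      · rw [subPf_eq_mul_signedPf, mul_comm]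
        simp
      · intro i _ hi
        simp [Pi.single_eq_of_ne hi]
      · simp
    · rintro _ ⟨u, rfl⟩ s hs
      obtain ⟨r, rfl⟩ := Ideal.mem_span_singleton'.mp hs
      refine ⟨(((-1) ^ (n + i₀ : ℕ) * r) • u, 0), ?_⟩
      rw [hd, map_smul, subPf_eq_mul_signedPf]
      simp only [Pi.zero_apply, mul_zero, Finset.sum_const_zero, add_zero, smul_eq_mul]
      ring

end TrimmedPfaffians

/-- Functions on two finite types, as functions on `Fin m`. -/
def prodArrowEquivFin (R : Type*) [CommRing R] {ι κ : Type*} [Fintype ι] [Fintype κ] {m : ℕ}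
    (h : Fintype.card (ι ⊕ κ) = m) : ((ι → R) × (κ → R)) ≃ₗ[R] (Fin m → R) :=
  (LinearEquiv.sumArrowLequivProdArrow ι κ R R).symm ≪≫ₗ
    LinearEquiv.funCongrLeft R R (Fintype.equivFinOfCardEq h).symm

/-- An exact pair conjugated by linear equivalences is exact. -/
lemma ker_conj_eq_range_conj {R E₃ E₂ E₁ F₃ F₂ F₁ : Type*} [CommRing R]
    [AddCommGroup E₃] [Module R E₃] [AddCommGroup E₂] [Module R E₂] [AddCommGroup E₁] [Module R E₁]
    [AddCommGroup F₃] [Module R F₃] [AddCommGroup F₂] [Module R F₂] [AddCommGroup F₁] [Module R F₁]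
    {f : E₃ →ₗ[R] E₂} {g : E₂ →ₗ[R] E₁} (h : Function.Exact f g)
    (e₃ : E₃ ≃ₗ[R] F₃) (e₂ : E₂ ≃ₗ[R] F₂) (e₁ : E₁ ≃ₗ[R] F₁) :
    LinearMap.ker (e₁.toLinearMap ∘ₗ g ∘ₗ e₂.symm.toLinearMap) =
      LinearMap.range (e₂.toLinearMap ∘ₗ f ∘ₗ e₃.symm.toLinearMap) := by
  ext v
  simp only [LinearMap.mem_ker, LinearMap.comp_apply, LinearEquiv.coe_coe,
    LinearEquiv.map_eq_zero_iff, LinearMap.mem_range]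
  refine (h _).trans ⟨fun ⟨u, hu⟩ => ⟨e₃ u, by simp [hu]⟩, fun ⟨u, hu⟩ => ⟨e₃.symm u, ?_⟩⟩
  rw [← hu, LinearEquiv.symm_apply_apply]

/-- Let `R` be a commutative Noetherian ring, `n ≥ 1`, `M` a
`(2n+1)×(2n+1)` alternating matrix over `R`, `i₀` an index, and `x : R³ → R` an
`R`-linear map.  Assume (a) the ideal `im x` has grade 3; (b) the ideal `Pf(M)` of
submaximal Pfaffians is a grade 3 Gorenstein ideal (by Buchsbaum–Eisenbud, a Pfaffian
ideal of an odd-size alternating matrix of grade 3 is automatically Gorenstein of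
grade 3, so this is exactly the grade condition); (c) every entry of the `i₀`-th row of
`M` lies in `im x`; (d) `Pf_{i₀}(M)` is a non-zerodivisor on `R`.  Set
`𝓘 = (Pf_j(M) : j ≠ i₀) + (im x)·Pf_{i₀}(M)`.  Then `R/𝓘` admits a free resolution
`0 → R² → R^{2n+4} → R^{2n+3} → R → R/𝓘 → 0`; in particular `𝓘` is a perfect ideal of
grade 3 and `R/𝓘` has projective dimension 3 over `R` (perfection = the existence of
this length-3 free resolution together with `grade 𝓘 = 3`). -/
theorem statement_0 (R : Type) [CommRing R] [IsNoetherianRing R] (n : ℕ) (hn : 1 ≤ n)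
    (M : Matrix (Fin (2 * n + 1)) (Fin (2 * n + 1)) R) (hM : IsAlternating M)
    (i₀ : Fin (2 * n + 1)) (x : (Fin 3 → R) →ₗ[R] R)
    (ha : hasGrade (LinearMap.range x) 3)
    (hb : hasGrade (pfIdeal M) 3)
    (hc : ∀ j, M i₀ j ∈ LinearMap.range x)
    (hd : ∀ r : R, r * subPf M i₀ = 0 → r = 0) :
    (∃ (d3 : (Fin 2 → R) →ₗ[R] (Fin (2 * n + 4) → R))
        (d2 : (Fin (2 * n + 4) → R) →ₗ[R] (Fin (2 * n + 3) → R))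
        (d1 : (Fin (2 * n + 3) → R) →ₗ[R] R),
      Function.Injective d3 ∧
      LinearMap.ker d2 = LinearMap.range d3 ∧
      LinearMap.ker d1 = LinearMap.range d2 ∧
      LinearMap.range d1 = trimPf M i₀ (LinearMap.range x)) ∧
    hasGrade (trimPf M i₀ (LinearMap.range x)) 3 := by
  classical
  let χ : Fin 3 → R := fun k => x (Pi.single k 1)
  have hχ (u : Fin 3 → R) : χ ⬝ᵥ u = x u := dotProduct_apply_single x u
  have hspan : Ideal.span (Set.range χ) = LinearMap.range x := by
    refine le_antisymm (Ideal.span_le.mpr ?_) ?_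
    · rintro _ ⟨k, rfl⟩
      exact ⟨_, rfl⟩
    · rintro _ ⟨u, rfl⟩
      rw [← hχ]
      exact Ideal.sum_mem _ fun k _ => Ideal.mul_mem_right _ _ (Ideal.subset_span ⟨k, rfl⟩)
  constructor
  · have hM' := isHomotopyData_signedPf hM
    have hx := isHomotopyData_crossMatrix χ
    obtain ⟨a, haM, b, hbM, c, hcM, habc⟩ := exists_isWeaklyRegularTriple hb.1
    obtain ⟨a', ha', b', hb', c', hc', habc'⟩ := exists_isWeaklyRegularTriple ha.1
    rw [← span_range_signedPf] at haM hbM hcM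
    rw [← hspan] at ha' hb' hc'
    choose y hy using hc
    let Y : Matrix (Fin 3) (Fin (2 * n + 1)) R := Matrix.of fun k j => y j k
    have hY (w : Fin (2 * n + 1) → R) : χ ⬝ᵥ Matrix.mulVec Y w = Matrix.mulVec M w i₀ := by
      rw [Matrix.dotProduct_mulVec, Matrix.mulVec]
      congr 1
      ext j
      rw [← hy, ← hχ]
      rfl
    have hYp : χ ⬝ᵥ Matrix.mulVec Y (signedPf M) = 0 := by
      rw [hY, hM'.mulVec_eq_zero]
      rfl
    obtain ⟨z, hz⟩ := hx.exact_dotProduct habc' ha' hb' hc' hYp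
    let e₃ := (LinearEquiv.finTwoArrow R R).symm
    let e₂ := prodArrowEquivFin R (ι := Fin (2 * n + 1)) (κ := Fin 3) (m := 2 * n + 4) (by simp)
    let e₁ := prodArrowEquivFin R (ι := Fin 3) (κ := {i // i ≠ i₀}) (m := 2 * n + 3)
      (by simp [Fintype.card_subtype_compl, add_comm])
    refine ⟨e₂.toLinearMap ∘ₗ trimSyzygies (signedPf M) χ z ∘ₗ e₃.symm.toLinearMap,
      e₁.toLinearMap ∘ₗ trimRelations M χ Y i₀ ∘ₗ e₂.symm.toLinearMap,
      (LinearEquiv.refl R R).toLinearMap ∘ₗ trimGenerators (signedPf M) χ i₀ ∘ₗ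
        e₁.symm.toLinearMap, ?_, ?_, ?_, ?_⟩
    · exact e₂.injective.comp
        ((trimSyzygies_injective z habc haM habc' ha').comp e₃.symm.injective)
    · exact ker_conj_eq_range_conj
        (hM'.exact_trimSyzygies habc haM hbM habc' ha' hb' hY hz) e₃ e₂ e₁
    · exact ker_conj_eq_range_conj
        (hM'.exact_trimRelations habc haM hbM hcM habc' ha' hb' hc' hY) e₂ e₁ (.refl R R)
    · rw [← range_trimGenerators i₀ x]
      refine le_antisymm ?_ ?_
      · rintro _ ⟨v, rfl⟩
        exact ⟨e₁.symm v, rfl⟩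
      · rintro _ ⟨v, rfl⟩
        exact ⟨e₁ v, 
          congrArg (trimGenerators (signedPf M) χ i₀) (e₁.symm_apply_apply v)⟩
  · have hle := trimPf_le_pfIdeal M i₀ (LinearMap.range x)
    refine ⟨?_, fun h => hb.2 (gradeGE_mono hle h)⟩
    by_cases htop : trimPf M i₀ (LinearMap.range x) = ⊤
    · exact gradeGE_mono (htop ▸ le_top) hb.1
    · obtain ⟨a, haI, b, hbI, c, hcI, habc⟩ := exists_isWeaklyRegularTriple_mul ha.1 hb.1
      have hle' := mul_pfIdeal_le_trimPf M i₀ (LinearMap.range x)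
      exact gradeGE_of_triple htop (hle' haI) (hle' hbI) (hle' hcI) habc

end
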